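/- arXiv:0902.1324 — 2 statements merged into one kernel-verified Lean document; each statement's English description precedes it below -/
import Mathlib

section
/- Exactness criterion (multiplicity one): let u* be a minimizer of the dual function θ, and suppose the largest eigenvalue of A(u*) = D(u*) − M − ((u*)ᵀe/(n+1))·I has a one-dimensional eigenspace. Then θ(u*) = opt(BLS), and every eigenvector x of A(u*) associated with λmax(A(u*)) satisfying xᵀx = n+1 has all entries in {−1,1} and satisfies −xᵀMx = opt(BLS). -/
open Matrix

noncomputable section

/-- The largest eigenvalue of a real (symmetric) matrix, i.e. the supremum of its spectrum. -/
def lamMax {k : Type*} [Fintype k] [DecidableEq k] (S : Matrix k k ℝ) : ℝ :=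
  sSup (spectrum ℝ S)

/-- The block matrix `M = [[AᵀA + νP, −Aᵀy], [−yᵀA, yᵀy]]`, acting on `ℝ^{n+1} = ℝ^n ⊕ ℝ`. -/
def Mmat {m n : ℕ} (A : Matrix (Fin m) (Fin n) ℝ) (y : Fin m → ℝ) (ν : ℝ)
    (P : Matrix (Fin n) (Fin n) ℝ) : Matrix (Fin n ⊕ Unit) (Fin n ⊕ Unit) ℝ :=
  Matrix.fromBlocks (Aᵀ * A + ν • P)
    (Matrix.of fun i (_ : Unit) => -(Aᵀ *ᵥ y) i)
    (Matrix.of fun (_ : Unit) j => -(Aᵀ *ᵥ y) j)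
    (Matrix.of fun _ _ => y ⬝ᵥ y)

/-- The matrix `A(u) = D(u) − M − (uᵀe/(n+1))·I`. -/
def Amat {m n : ℕ} (A : Matrix (Fin m) (Fin n) ℝ) (y : Fin m → ℝ) (ν : ℝ)
    (P : Matrix (Fin n) (Fin n) ℝ) (u : Fin n ⊕ Unit → ℝ) :
    Matrix (Fin n ⊕ Unit) (Fin n ⊕ Unit) ℝ :=
  Matrix.diagonal u - Mmat A y ν P - ((u ⬝ᵥ (fun _ => 1)) / (n + 1 : ℝ)) • 1

/-- The dual function `θ(u) = (n+1)·λmax(A(u))`. -/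
def theta {m n : ℕ} (A : Matrix (Fin m) (Fin n) ℝ) (y : Fin m → ℝ) (ν : ℝ)
    (P : Matrix (Fin n) (Fin n) ℝ) (u : Fin n ⊕ Unit → ℝ) : ℝ :=
  (n + 1 : ℝ) * lamMax (Amat A y ν P u)

/-- The set of values `−xᵀMx` over binary vectors `x ∈ {−1,1}^{n+1}`;
its supremum (a maximum) is `opt(BLS)`. -/
def BLSvals {n : ℕ} (M : Matrix (Fin n ⊕ Unit) (Fin n ⊕ Unit) ℝ) : Set ℝ :=
  {t | ∃ x : Fin n ⊕ Unit → ℝ, (∀ i, x i = 1 ∨ x i = -1) ∧ t = -(x ⬝ᵥ (M *ᵥ x))}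

section LargestEigenvalue

theorem isCompact_dotProduct_self_eq {k : Type*} [Fintype k] (c : ℝ) : IsCompact {v : k → ℝ | v ⬝ᵥ v = c} := by
  refine Metric.isCompact_of_isClosed_isBounded (isClosed_eq (by fun_prop) continuous_const) ?_
  refine (Metric.isBounded_closedBall (x := (0 : k → ℝ)) (r := √c)).subset fun v hv => ?_
  rw [mem_closedBall_zero_iff, pi_norm_le_iff_of_nonneg (Real.sqrt_nonneg c)]
  intro i
  rw [Real.norm_eq_abs]
  refine Real.abs_le_sqrt ?_
  rw [← show v ⬝ᵥ v = c from hv, pow_two]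
  exact Finset.single_le_sum (f := fun i => v i * v i) (fun i _ => mul_self_nonneg _)
    (Finset.mem_univ i)

variable {k : Type*} [Fintype k] [DecidableEq k]

theorem lamMax_isGreatest [Nonempty k] {S : Matrix k k ℝ} (hS : S.IsHermitian) :
    IsGreatest (spectrum ℝ S) (lamMax S) := by
  have hr : spectrum ℝ S = Set.range hS.eigenvalues := hS.spectrum_real_eq_range_eigenvalues
  have hfin : (spectrum ℝ S).Finite := hr ▸ Set.finite_range _
  have hne : (spectrum ℝ S).Nonempty := hr ▸ Set.range_nonempty _
  exact ⟨hne.csSup_mem hfin, fun _ ht => le_csSup hfin.bddAbove ht⟩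

theorem posSemidef_lamMax_sub [Nonempty k] {S : Matrix k k ℝ} (hS : S.IsHermitian) :
    (lamMax S • (1 : Matrix k k ℝ) - S).PosSemidef := by
  have hT : (lamMax S • (1 : Matrix k k ℝ) - S).IsHermitian :=
    IsHermitian.sub (by simp [IsHermitian]) hS
  rw [hT.posSemidef_iff_eigenvalues_nonneg]
  intro i
  obtain ⟨r, hr⟩ : ∃ r, hT.eigenvalues i = r := ⟨_, rfl⟩
  have hi : r ∈ spectrum ℝ (lamMax S • (1 : Matrix k k ℝ) - S) := by
    rw [hT.spectrum_real_eq_range_eigenvalues]; exact ⟨i, hr⟩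
  rw [← Algebra.algebraMap_eq_smul_one, ← spectrum.singleton_sub_eq] at hi
  obtain ⟨_, rfl, s, hs, hsi⟩ := hi
  have := (lamMax_isGreatest hS).2 hs
  rw [Pi.zero_apply, hr, ← hsi]
  exact sub_nonneg.2 this

theorem dotProduct_lamMax_sub (S : Matrix k k ℝ) (v : k → ℝ) :
    v ⬝ᵥ ((lamMax S • (1 : Matrix k k ℝ) - S) *ᵥ v) = lamMax S * (v ⬝ᵥ v) - v ⬝ᵥ (S *ᵥ v) := by
  simp [sub_mulVec, smul_mulVec]

theorem dotProduct_mulVec_le_lamMax [Nonempty k] {S : Matrix k k ℝ} (hS : S.IsHermitian)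
    (v : k → ℝ) : v ⬝ᵥ (S *ᵥ v) ≤ lamMax S * (v ⬝ᵥ v) := by
  have h := (posSemidef_lamMax_sub hS).dotProduct_mulVec_nonneg v
  rw [star_trivial, dotProduct_lamMax_sub] at h
  linarith

theorem mulVec_eq_lamMax_smul_of_le [Nonempty k] {S : Matrix k k ℝ} (hS : S.IsHermitian)
    {v : k → ℝ} (hv : lamMax S * (v ⬝ᵥ v) ≤ v ⬝ᵥ (S *ᵥ v)) : S *ᵥ v = lamMax S • v := by
  have h0 : star v ⬝ᵥ ((lamMax S • (1 : Matrix k k ℝ) - S) *ᵥ v) = 0 := by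
    rw [star_trivial, dotProduct_lamMax_sub]
    linarith [dotProduct_mulVec_le_lamMax hS v]
  rw [(posSemidef_lamMax_sub hS).dotProduct_mulVec_zero_iff] at h0
  simp only [sub_mulVec, smul_mulVec, one_mulVec] at h0
  exact (sub_eq_zero.1 h0).symm

theorem exists_mulVec_eq_lamMax_smul [Nonempty k] {S : Matrix k k ℝ} (hS : S.IsHermitian)
    {c : ℝ} (hc : 0 < c) : ∃ v : k → ℝ, v ⬝ᵥ v = c ∧ S *ᵥ v = lamMax S • v := by
  have h := (lamMax_isGreatest hS).1
  rw [← Matrix.spectrum_toLin', ← Module.End.hasEigenvalue_iff_mem_spectrum] at h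
  obtain ⟨v, hv⟩ := h.exists_hasEigenvector
  have hev : S *ᵥ v = lamMax S • v := by simpa using hv.apply_eq_smul
  have hpos : 0 < v ⬝ᵥ v := by simpa using dotProduct_star_self_pos_iff.2 hv.2
  refine ⟨√(c / (v ⬝ᵥ v)) • v, ?_, ?_⟩
  · rw [smul_dotProduct, dotProduct_smul, smul_eq_mul, smul_eq_mul, ← mul_assoc,
      Real.mul_self_sqrt (by positivity)]
    field_simp
  · rw [mulVec_smul, hev, smul_comm]

theorem dotProduct_diagonal_mulVec (d v : k → ℝ) :
    v ⬝ᵥ (diagonal d *ᵥ v) = ∑ i, d i * v i ^ 2 := by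
  simp only [dotProduct, mulVec_diagonal]
  exact Finset.sum_congr rfl fun i _ => by ring

/-- If `lamMax` does not decrease along the ray `S - t • diagonal d`, `t ≥ 0`, then some top
eigenvector of `S` has a nonpositive quadratic form against `diagonal d`. -/
theorem exists_top_eigenvector_sum_nonpos [Nonempty k] {S : Matrix k k ℝ} (hS : S.IsHermitian)
    {d : k → ℝ} (hmin : ∀ t : ℝ, 0 < t → lamMax S ≤ lamMax (S - t • diagonal d)) {c : ℝ}
    (hc : 0 < c) :
    ∃ v : k → ℝ, v ⬝ᵥ v = c ∧ S *ᵥ v = lamMax S • v ∧ ∑ i, d i * v i ^ 2 ≤ 0 := by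
  have key : ∀ j : ℕ, ∃ v : k → ℝ, v ⬝ᵥ v = c ∧ ∑ i, d i * v i ^ 2 ≤ 0 ∧
      lamMax S * c ≤ v ⬝ᵥ (S *ᵥ v) - (1 / ((j : ℝ) + 1)) * ∑ i, d i * v i ^ 2 := by
    intro j
    have ht : (0 : ℝ) < 1 / ((j : ℝ) + 1) := by positivity
    set t : ℝ := 1 / ((j : ℝ) + 1)
    have hSt : (S - t • diagonal d).IsHermitian :=
      hS.sub (by simp [IsHermitian])
    obtain ⟨v, hvc, hv⟩ := exists_mulVec_eq_lamMax_smul hSt hc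
    have h1 : v ⬝ᵥ ((S - t • diagonal d) *ᵥ v) = lamMax (S - t • diagonal d) * c := by
      rw [hv, dotProduct_smul, hvc, smul_eq_mul]
    rw [sub_mulVec, smul_mulVec, dotProduct_sub, dotProduct_smul, dotProduct_diagonal_mulVec,
      smul_eq_mul] at h1
    have h2 : lamMax S * c ≤ lamMax (S - t • diagonal d) * c :=
      mul_le_mul_of_nonneg_right (hmin t ht) hc.le
    have h3 := dotProduct_mulVec_le_lamMax hS v
    rw [hvc] at h3
    refine ⟨v, hvc, ?_, by linarith⟩
    exact nonpos_of_mul_nonpos_right (by linarith : t * _ ≤ 0) ht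
  choose w hwc hwd hw using key
  obtain ⟨v, hvc, φ, hφ, hlim⟩ := (isCompact_dotProduct_self_eq (k := k) c).tendsto_subseq hwc
  have hQ : Continuous fun v : k → ℝ => ∑ i, d i * v i ^ 2 := by fun_prop
  have hR : Continuous fun v : k → ℝ => v ⬝ᵥ (S *ᵥ v) := by fun_prop
  have hQl := (hQ.tendsto v).comp hlim
  have hRl := (hR.tendsto v).comp hlim
  have htl := (tendsto_one_div_add_atTop_nhds_zero_nat (𝕜 := ℝ)).comp hφ.tendsto_atTop
  refine ⟨v, hvc, mulVec_eq_lamMax_smul_of_le hS ?_, le_of_tendsto' hQl fun j => hwd _⟩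
  have h := ge_of_tendsto' (hRl.sub (htl.mul hQl)) fun j => hw (φ j)
  rw [zero_mul, sub_zero] at h
  rwa [show v ⬝ᵥ v = c from hvc]

/-- First-order optimality of `lamMax` under trace-free diagonal perturbations, at a simple top
eigenvalue. -/
theorem sq_eq_one_of_lamMax_minimal [Nonempty k] {S : Matrix k k ℝ} (hS : S.IsHermitian)
    (hmin : ∀ d : k → ℝ, ∑ i, d i = 0 → lamMax S ≤ lamMax (S - diagonal d))
    (hmult : Module.finrank ℝ (Module.End.eigenspace (Matrix.toLin' S) (lamMax S)) = 1)
    {x : k → ℝ} (hx : S *ᵥ x = lamMax S • x) (hxx : x ⬝ᵥ x = Fintype.card k) (i : k) :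
    x i ^ 2 = 1 := by
  have hc : (0 : ℝ) < Fintype.card k := by exact_mod_cast Fintype.card_pos
  set d : k → ℝ := fun i => x i ^ 2 - 1 with hd
  have hsum : ∑ i, x i ^ 2 = Fintype.card k := by
    rw [← hxx]; exact Finset.sum_congr rfl fun i _ => pow_two _
  have hd0 : ∑ i, d i = 0 := by simp [hd, hsum]
  obtain ⟨v, hvv, hv, hvd⟩ := exists_top_eigenvector_sum_nonpos hS (d := d) (fun t _ => by
    rw [← diagonal_smul]
    exact hmin _ (by simp [← Finset.mul_sum, hd0])) hc
  have hx0 : x ≠ 0 := by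
    rintro rfl
    rw [zero_dotProduct] at hxx
    exact hc.ne hxx
  obtain ⟨a, ha⟩ := (finrank_eq_one_iff_of_nonzero'
    (⟨x, by simpa [Module.End.mem_eigenspace_iff] using hx⟩ :
      Module.End.eigenspace (Matrix.toLin' S) (lamMax S)) (by simpa using hx0)).1 hmult
    ⟨v, by simpa [Module.End.mem_eigenspace_iff] using hv⟩
  have hav : v = a • x := (congrArg Subtype.val ha).symm
  have ha2 : a ^ 2 = 1 := by
    rw [hav, smul_dotProduct, dotProduct_smul, hxx, smul_eq_mul, smul_eq_mul] at hvv
    have := hc.ne'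
    field_simp at hvv
    exact hvv
  have hdx : ∑ i, d i ^ 2 ≤ 0 := by
    calc ∑ i, d i ^ 2 = ∑ i, d i * v i ^ 2 - ∑ i, d i := by
          rw [← Finset.sum_sub_distrib]
          refine Finset.sum_congr rfl fun i _ => ?_
          simp only [hav, Pi.smul_apply, smul_eq_mul, mul_pow, ha2, hd]
          ring
      _ ≤ 0 := by rw [hd0]; linarith
  have h0 := (Finset.sum_eq_zero_iff_of_nonneg fun i _ => sq_nonneg (d i)).1
    (le_antisymm hdx (Finset.sum_nonneg fun i _ => sq_nonneg (d i))) i (Finset.mem_univ i)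
  have : d i = 0 := by simpa using h0
  simp only [hd] at this
  linarith

end LargestEigenvalue

section BinaryLeastSquares

variable {m n : ℕ} (A : Matrix (Fin m) (Fin n) ℝ) (y : Fin m → ℝ) (ν : ℝ)
  (P : Matrix (Fin n) (Fin n) ℝ) (u : Fin n ⊕ Unit → ℝ)

theorem Mmat_isHermitian {P : Matrix (Fin n) (Fin n) ℝ} (hP : P.IsSymm) :
    (Mmat A y ν P).IsHermitian := by
  refine IsHermitian.fromBlocks ?_ ?_ ?_
  · simp [IsHermitian, conjTranspose_eq_transpose_of_trivial, hP.eq]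
  · ext i j
    simp
  · ext i j
    simp

theorem Amat_isHermitian {P : Matrix (Fin n) (Fin n) ℝ} (hP : P.IsSymm) :
    (Amat A y ν P u).IsHermitian :=
  IsHermitian.sub (IsHermitian.sub (by simp [IsHermitian]) (Mmat_isHermitian A y ν hP))
    (by simp [IsHermitian])

theorem Amat_sub_of_sum_eq_zero {d : Fin n ⊕ Unit → ℝ} (hd : ∑ i, d i = 0) :
    Amat A y ν P (u - d) = Amat A y ν P u - diagonal d := by
  have hd' : d ⬝ᵥ (fun _ => 1) = 0 := by simpa [dotProduct] using hd
  rw [Amat, Amat, sub_dotProduct, hd', sub_zero,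
    show diagonal (u - d) = diagonal u - diagonal d from (diagonal_sub u d).symm]
  abel

theorem dotProduct_Amat_mulVec_of_binary {x : Fin n ⊕ Unit → ℝ} (hx : ∀ i, x i ^ 2 = 1) :
    x ⬝ᵥ (Amat A y ν P u *ᵥ x) = -(x ⬝ᵥ (Mmat A y ν P *ᵥ x)) := by
  have hxx : x ⬝ᵥ x = n + 1 := by simp [dotProduct, ← pow_two, hx]
  have hn : (n + 1 : ℝ) ≠ 0 := by positivity
  rw [Amat, sub_mulVec, sub_mulVec, smul_mulVec, one_mulVec, dotProduct_sub, dotProduct_sub,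
    dotProduct_smul, dotProduct_diagonal_mulVec, hxx, smul_eq_mul, div_mul_cancel₀ _ hn]
  simp only [hx, dotProduct, mul_one]
  ring

end BinaryLeastSquares

/-- Exactness criterion (multiplicity one): if `u*` minimizes `θ` and the top
eigenvalue of `A(u*)` has a one-dimensional eigenspace, then `θ(u*) = opt(BLS)` and every
eigenvector `x` of `A(u*)` for `λmax(A(u*))` with `xᵀx = n+1` is a binary optimal
solution of (BLS). -/
theorem exactness_multiplicity_one {m n : ℕ} (A : Matrix (Fin m) (Fin n) ℝ) (y : Fin m → ℝ)
    (ν : ℝ) (hν : 0 ≤ ν) (P : Matrix (Fin n) (Fin n) ℝ) (hP : P.IsSymm)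
    (ustar : Fin n ⊕ Unit → ℝ)
    (hmin : ∀ u : Fin n ⊕ Unit → ℝ, theta A y ν P ustar ≤ theta A y ν P u)
    (hmult : Module.finrank ℝ
      (Module.End.eigenspace (Matrix.toLin' (Amat A y ν P ustar))
        (lamMax (Amat A y ν P ustar))) = 1) :
    theta A y ν P ustar = sSup (BLSvals (Mmat A y ν P)) ∧
      ∀ x : Fin n ⊕ Unit → ℝ,
        Amat A y ν P ustar *ᵥ x = lamMax (Amat A y ν P ustar) • x →
        x ⬝ᵥ x = (n + 1 : ℝ) →
        (∀ i, x i = 1 ∨ x i = -1) ∧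
          -(x ⬝ᵥ (Mmat A y ν P *ᵥ x)) = sSup (BLSvals (Mmat A y ν P)) := by
  have hS := Amat_isHermitian A y ν ustar hP
  have hn : (0 : ℝ) < n + 1 := by positivity
  have hbin : ∀ x : Fin n ⊕ Unit → ℝ,
      Amat A y ν P ustar *ᵥ x = lamMax (Amat A y ν P ustar) • x →
      x ⬝ᵥ x = (n + 1 : ℝ) → ∀ i, x i ^ 2 = 1 := by
    intro x hx hxx
    refine sq_eq_one_of_lamMax_minimal hS (fun d hd => ?_) hmult hx (by simpa using hxx)
    rw [← Amat_sub_of_sum_eq_zero A y ν P ustar hd]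
    exact le_of_mul_le_mul_left (hmin (ustar - d)) hn
  have hval : ∀ x : Fin n ⊕ Unit → ℝ,
      Amat A y ν P ustar *ᵥ x = lamMax (Amat A y ν P ustar) • x →
      x ⬝ᵥ x = (n + 1 : ℝ) → -(x ⬝ᵥ (Mmat A y ν P *ᵥ x)) = theta A y ν P ustar := by
    intro x hx hxx
    rw [← dotProduct_Amat_mulVec_of_binary A y ν P ustar (hbin x hx hxx), hx, dotProduct_smul,
      hxx, smul_eq_mul, theta, mul_comm]
  have hgreatest : IsGreatest (BLSvals (Mmat A y ν P)) (theta A y ν P ustar) := by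
    constructor
    · obtain ⟨x, hxx, hx⟩ := exists_mulVec_eq_lamMax_smul hS hn
      exact ⟨x, fun i => sq_eq_one_iff.1 (hbin x hx hxx i), (hval x hx hxx).symm⟩
    · rintro _ ⟨z, hz, rfl⟩
      have hz2 : ∀ i, z i ^ 2 = 1 := fun i => sq_eq_one_iff.2 (hz i)
      have hzz : z ⬝ᵥ z = n + 1 := by simp [dotProduct, ← pow_two, hz2]
      rw [← dotProduct_Amat_mulVec_of_binary A y ν P ustar hz2, theta, mul_comm, ← hzz]
      exact dotProduct_mulVec_le_lamMax hS z
  refine ⟨hgreatest.csSup_eq.symm, fun x hx hxx => ⟨fun i => ?_, ?_⟩⟩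
  · exact sq_eq_one_iff.1 (hbin x hx hxx i)
  · rw [hval x hx hxx, hgreatest.csSup_eq]
end
end

section
/- Subgradients of the dual function from the top eigenspace: let u ∈ ℝ^{n+1}, let E be a real (n+1)×r matrix whose columns form an orthonormal basis of the eigenspace of A(u) = D(u) − M − (uᵀe/(n+1))·I associated with λmax(A(u)), and let Z be a real symmetric r×r positive semidefinite matrix with trace(Z) = 1. Then the vector g = (n+1)·diag(EZEᵀ) − trace(EZEᵀ)·e is a subgradient of θ at u, i.e. θ(u') ≥ θ(u) + ⟨g, u' − u⟩ for all u' ∈ ℝ^{n+1}. -/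
open Matrix

noncomputable section

open scoped MatrixOrder Matrix.Norms.L2Operator in
/-- The trace of a product of two positive semidefinite matrices is nonnegative. -/
lemma trace_mul_nonneg_of_posSemidef {k : Type*} [Fintype k] [DecidableEq k]
    {Q X : Matrix k k ℝ} (hQ : Q.PosSemidef) (hX : X.PosSemidef) : 0 ≤ (Q * X).trace := by
  obtain ⟨B, rfl⟩ := CStarAlgebra.nonneg_iff_eq_star_mul_self.mp hX.nonneg
  have h := (hQ.mul_mul_conjTranspose_same B).trace_nonneg
  rwa [Matrix.mul_assoc, Matrix.trace_mul_comm, Matrix.mul_assoc] at h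

/-- A symmetric matrix is bounded above by its largest eigenvalue. -/
lemma posSemidef_lamMax_smul_one_sub {k : Type*} [Fintype k] [DecidableEq k]
    {S : Matrix k k ℝ} (hS : S.IsHermitian) : (lamMax S • (1 : Matrix k k ℝ) - S).PosSemidef := by
  rw [Matrix.posSemidef_iff_isHermitian_and_spectrum_nonneg]
  refine ⟨(Matrix.isHermitian_one.smul (IsSelfAdjoint.all _)).sub hS, ?_⟩
  rw [← Algebra.algebraMap_eq_smul_one, ← spectrum.singleton_sub_eq]
  rintro _ ⟨_, rfl, b, hb, rfl⟩
  exact sub_nonneg.mpr (le_csSup (Matrix.finite_spectrum S).bddAbove hb)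

/-- The Rayleigh-type bound `⟨S, X⟩ ≤ λmax(S) · trace(X)` for positive semidefinite `X`. -/
lemma trace_mul_le_lamMax_mul_trace {k : Type*} [Fintype k] [DecidableEq k]
    {S X : Matrix k k ℝ} (hS : S.IsHermitian) (hX : X.PosSemidef) :
    (S * X).trace ≤ lamMax S * X.trace := by
  have h := trace_mul_nonneg_of_posSemidef (posSemidef_lamMax_smul_one_sub hS) hX
  simpa [Matrix.sub_mul, Matrix.trace_sub, Matrix.trace_smul] using h

lemma isHermitian_Amat {m n : ℕ} (A : Matrix (Fin m) (Fin n) ℝ) (y : Fin m → ℝ) (ν : ℝ)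
    {P : Matrix (Fin n) (Fin n) ℝ} (hP : P.IsSymm) (u : Fin n ⊕ Unit → ℝ) :
    (Amat A y ν P u).IsHermitian := by
  have hM : (Mmat A y ν P).IsHermitian := by
    refine Matrix.IsHermitian.fromBlocks ?_ ?_ ?_
    · simp [Matrix.IsHermitian, Matrix.conjTranspose_eq_transpose_of_trivial, hP.eq]
    · ext i j
      simp
    · ext i j
      simp
  exact ((Matrix.isHermitian_diagonal u).sub hM).sub
    (Matrix.isHermitian_one.smul (IsSelfAdjoint.all _))

lemma trace_diagonal_mul {k : Type*} [Fintype k] [DecidableEq k] (d : k → ℝ)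
    (X : Matrix k k ℝ) : (Matrix.diagonal d * X).trace = X.diag ⬝ᵥ d := by
  simp [Matrix.trace, dotProduct, Matrix.diagonal_mul, mul_comm]

lemma trace_Amat_mul {m n : ℕ} (A : Matrix (Fin m) (Fin n) ℝ) (y : Fin m → ℝ) (ν : ℝ)
    (P : Matrix (Fin n) (Fin n) ℝ) (u : Fin n ⊕ Unit → ℝ)
    (X : Matrix (Fin n ⊕ Unit) (Fin n ⊕ Unit) ℝ) :
    (Amat A y ν P u * X).trace = X.diag ⬝ᵥ u - (Mmat A y ν P * X).trace
      - (u ⬝ᵥ fun _ => 1) / (n + 1 : ℝ) * X.trace := by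
  simp [Amat, Matrix.sub_mul, Matrix.trace_sub, Matrix.trace_smul, trace_diagonal_mul]

/-- subgradients of the dual function from the top eigenspace: if the columns
of `E` form an orthonormal basis of the eigenspace of `A(u)` for `λmax(A(u))` and `Z ⪰ 0`
has `trace(Z) = 1`, then `g = (n+1)·diag(EZEᵀ) − trace(EZEᵀ)·e` is a subgradient of `θ`
at `u`: `θ(u') ≥ θ(u) + ⟨g, u' − u⟩` for all `u'`. -/
theorem subgradient_from_top_eigenspace {m n r : ℕ} (A : Matrix (Fin m) (Fin n) ℝ)
    (y : Fin m → ℝ) (ν : ℝ) (hν : 0 ≤ ν) (P : Matrix (Fin n) (Fin n) ℝ) (hP : P.IsSymm)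
    (u : Fin n ⊕ Unit → ℝ)
    (E : Matrix (Fin n ⊕ Unit) (Fin r) ℝ)
    (horth : Eᵀ * E = 1)
    (heig : Amat A y ν P u * E = lamMax (Amat A y ν P u) • E)
    (hspan : ∀ x : Fin n ⊕ Unit → ℝ,
      Amat A y ν P u *ᵥ x = lamMax (Amat A y ν P u) • x → ∃ c : Fin r → ℝ, x = E *ᵥ c)
    (Z : Matrix (Fin r) (Fin r) ℝ) (hZ : Z.PosSemidef) (hZtr : Z.trace = 1) :
    ∀ u' : Fin n ⊕ Unit → ℝ,
      theta A y ν P u +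
          (fun i => (n + 1 : ℝ) * (E * Z * Eᵀ).diag i - (E * Z * Eᵀ).trace) ⬝ᵥ (u' - u)
        ≤ theta A y ν P u' := by
  intro u'
  set X := E * Z * Eᵀ with hXdef
  have hX : X.PosSemidef := by
    simpa [Matrix.conjTranspose_eq_transpose_of_trivial] using hZ.mul_mul_conjTranspose_same E
  have hXtr : X.trace = 1 := by
    rw [hXdef, Matrix.trace_mul_comm, ← Matrix.mul_assoc, horth, Matrix.one_mul, hZtr]
  have hu : (Amat A y ν P u * X).trace = lamMax (Amat A y ν P u) := by
    rw [hXdef, Matrix.mul_assoc, ← Matrix.mul_assoc, heig, Matrix.smul_mul, Matrix.trace_smul,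
      ← Matrix.mul_assoc, ← hXdef, hXtr, smul_eq_mul, mul_one]
  have hu' := trace_mul_le_lamMax_mul_trace (isHermitian_Amat A y ν hP u') hX
  have hn : (0 : ℝ) < n + 1 := by positivity
  have hg : (fun i => (n + 1 : ℝ) * X.diag i - X.trace) ⬝ᵥ (u' - u)
      = (n + 1 : ℝ) * ((Amat A y ν P u' * X).trace - (Amat A y ν P u * X).trace) := by
    have hfun : (fun i => (n + 1 : ℝ) * X.diag i - X.trace)
        = (n + 1 : ℝ) • X.diag - X.trace • fun _ => 1 := by
      ext i
      simp
    rw [trace_Amat_mul, trace_Amat_mul, hfun, sub_dotProduct, smul_dotProduct, smul_dotProduct,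
      dotProduct_sub, dotProduct_sub, dotProduct_comm (fun _ => 1) u',
      dotProduct_comm (fun _ => 1) u, smul_eq_mul, smul_eq_mul]
    field_simp
    ring
  rw [hXtr, mul_one] at hu'
  rw [hg, theta, theta, hu, ← mul_add, add_sub_cancel]
  exact mul_le_mul_of_nonneg_left hu' hn.le
end
end
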